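/- arXiv:1802.03081 — 2 statements merged into one kernel-verified Lean document; each statement's English description precedes it below -/
import Mathlib

section
/- Let n ≥ 1 and let θ ∈ ℝ^n be such that 1, θ_1, …, θ_n are linearly independent over ℚ, and let (z_l) be a sequence of best approximations to θ (for simultaneous approximation). There exist constants c₁, c₂, c₃ > 0, depending only on n and θ, such that for every index l ≥ 2: (a) the rank-2 subgroup Λ_l of ℤ^{n+1} generated by z_l, z_{l+1} satisfies c₁ ξ_l q_{l+1} ≤ det Λ_l ≤ c₂ ξ_l q_{l+1}; (b) if z_{l−1}, z_l, z_{l+1} are linearly independent, then the rank-3 subgroup Γ_l generated by z_{l−1}, z_l, z_{l+1} satisfies det Γ_l ≤ c₃ ξ_{l−1} ξ_l q_{l+1}. -/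
open scoped BigOperators

noncomputable section

/-- The real vector attached to an integer vector. -/
def vecR {m : ℕ} (z : Fin m → ℤ) : Fin m → ℝ := fun i => (z i : ℝ)

/-- The approximation error `ξ = max_i |q θ_i - a_i|` of a vector
`z = (q, a_1, …, a_n) ∈ ℤ^(n+1)`. -/
def xi {n : ℕ} (θ : Fin n → ℝ) (z : Fin (n + 1) → ℤ) : ℝ :=
  ⨆ i : Fin n, |(z 0 : ℝ) * θ i - (z i.succ : ℝ)|

/-- A sequence of best approximations to `θ` for simultaneous approximation:
`z l = (q_l, a_{1,l}, …, a_{n,l})`, `q_l > 0`, `(q_l)` strictly increasing,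
`(ξ_l)` strictly decreasing, and any `q` with `0 < q < q_{l+1}` approximates
no better than `ξ_l`. -/
def IsBestApproxSeq {n : ℕ} (θ : Fin n → ℝ) (z : ℕ → Fin (n + 1) → ℤ) : Prop :=
  (∀ l, 0 < z l 0) ∧
  (StrictMono fun l => z l 0) ∧
  (StrictAnti fun l => xi θ (z l)) ∧
  ∀ l : ℕ, ∀ q : ℤ, 0 < q → q < z (l + 1) 0 → ∀ a : Fin n → ℤ,
    xi θ (z l) ≤ ⨆ i : Fin n, |(q : ℝ) * θ i - (a i : ℝ)|

/-- Gram matrix of a family of vectors in `ℝ^m` (standard inner product). -/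
def gram {r m : ℕ} (v : Fin r → Fin m → ℝ) : Matrix (Fin r) (Fin r) ℝ :=
  Matrix.of (fun i j => ∑ k, v i k * v j k)

/-- Covolume (volume of a fundamental parallelepiped) of the lattice generated
by a linearly independent family of vectors of `ℝ^m`. -/
def covol {r m : ℕ} (v : Fin r → Fin m → ℝ) : ℝ := Real.sqrt (gram v).det

theorem gram_eq_dotProduct {r m : ℕ} (v : Fin r → Fin m → ℝ) :
    gram v = Matrix.of fun i j => v i ⬝ᵥ v j := rfl

/-- Gram determinants of pairs are invariant under adding a multiple of one vector to the other. -/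
theorem det_gram_pair_sub_smul {m : ℕ} (x y : Fin m → ℝ) (s : ℝ) :
    (gram ![x - s • y, y]).det = (gram ![x, y]).det := by
  simp only [gram_eq_dotProduct, Matrix.det_fin_two, Matrix.of_apply, Matrix.cons_val,
    sub_dotProduct, dotProduct_sub, smul_dotProduct, dotProduct_smul, smul_eq_mul]
  rw [dotProduct_comm y x]
  ring

/-- Gram determinants of triples are invariant under adding multiples of the last vector to the
others. -/
theorem det_gram_triple_sub_smul {m : ℕ} (x y w : Fin m → ℝ) (s t : ℝ) :
    (gram ![x - s • w, y - t • w, w]).det = (gram ![x, y, w]).det := by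
  simp only [gram_eq_dotProduct, Matrix.det_fin_three, Matrix.of_apply, Matrix.cons_val,
    sub_dotProduct, dotProduct_sub, smul_dotProduct, dotProduct_smul, smul_eq_mul]
  rw [dotProduct_comm y x, dotProduct_comm w x, dotProduct_comm w y]
  ring

theorem dotProduct_sq_le {m : ℕ} (x y : Fin m → ℝ) : (x ⬝ᵥ y) ^ 2 ≤ (x ⬝ᵥ x) * (y ⬝ᵥ y) := by
  simpa only [dotProduct, sq] using Finset.sum_mul_sq_le_sq_mul_sq Finset.univ x y

theorem dotProduct_self_nonneg_real {m : ℕ} (x : Fin m → ℝ) : 0 ≤ x ⬝ᵥ x :=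
  Finset.sum_nonneg fun i _ => mul_self_nonneg (x i)

theorem dotProduct_self_le {m : ℕ} {x : Fin m → ℝ} {b : ℝ} (h : ∀ k, |x k| ≤ b) :
    x ⬝ᵥ x ≤ m * b ^ 2 := by
  have hb : ∀ k ∈ Finset.univ, x k * x k ≤ b ^ 2 := fun k _ => by
    rw [← sq, ← sq_abs]
    exact pow_le_pow_left₀ (abs_nonneg _) (h k) 2
  simpa [dotProduct] using Finset.sum_le_card_nsmul _ _ _ hb

/-- Hadamard's inequality for pairs. -/
theorem det_gram_pair_le {m : ℕ} (x y : Fin m → ℝ) :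
    (gram ![x, y]).det ≤ (x ⬝ᵥ x) * (y ⬝ᵥ y) := by
  simp only [gram_eq_dotProduct, Matrix.det_fin_two, Matrix.of_apply, Matrix.cons_val]
  rw [dotProduct_comm y x]
  nlinarith [sq_nonneg (x ⬝ᵥ y)]

/-- Hadamard's inequality for triples. -/
theorem det_gram_triple_le {m : ℕ} (x y w : Fin m → ℝ) :
    (gram ![x, y, w]).det ≤ (x ⬝ᵥ x) * (y ⬝ᵥ y) * (w ⬝ᵥ w) := by
  simp only [gram_eq_dotProduct, Matrix.det_fin_three, Matrix.of_apply, Matrix.cons_val]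
  rw [dotProduct_comm y x, dotProduct_comm w x, dotProduct_comm w y]
  have hh := dotProduct_sq_le x y
  have hA := dotProduct_self_nonneg_real x
  have hB := dotProduct_self_nonneg_real y
  have hC := dotProduct_self_nonneg_real w
  generalize x ⬝ᵥ x = A at *
  generalize y ⬝ᵥ y = B at *
  generalize w ⬝ᵥ w = C at *
  generalize y ⬝ᵥ w = f at *
  generalize x ⬝ᵥ w = g at *
  generalize x ⬝ᵥ y = h at *
  have H : 2 * (f * g * h) ≤ A * f ^ 2 + B * g ^ 2 := by
    refine abs_le_of_sq_le_sq' ?_ (by positivity) |>.2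
    nlinarith [mul_le_mul_of_nonneg_left hh (sq_nonneg (f * g)),
      sq_nonneg (A * f ^ 2 - B * g ^ 2)]
  linarith [mul_nonneg hC (sq_nonneg h)]

/-- A Gram determinant of a pair dominates the square of each `2 × 2` minor. -/
theorem sq_minor_le_det_gram {m : ℕ} (x y : Fin m → ℝ) {i j : Fin m} (hij : i ≠ j) :
    (x i * y j - x j * y i) ^ 2 ≤ (gram ![x, y]).det := by
  have lagrange : ∑ p : Fin m × Fin m, (x p.1 * y p.2 - x p.2 * y p.1) ^ 2 =
      2 * (gram ![x, y]).det := by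
    simp only [gram, Matrix.det_fin_two, Matrix.of_apply, Matrix.cons_val,
      Fintype.sum_prod_type]
    have expand : ∀ i j, (x i * y j - x j * y i) ^ 2 = x i * x i * (y j * y j) +
        y i * y i * (x j * x j) - 2 * (x i * y i * (x j * y j)) := fun i j => by ring
    simp only [expand, Finset.sum_sub_distrib, Finset.sum_add_distrib, ← Finset.mul_sum,
      ← Finset.sum_mul, fun i => mul_comm (y i) (x i)]
    ring
  have hsub := Finset.sum_le_sum_of_subset_of_nonneg
    (f := fun p : Fin m × Fin m => (x p.1 * y p.2 - x p.2 * y p.1) ^ 2)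
    (Finset.subset_univ {(i, j), (j, i)}) fun p _ _ => sq_nonneg _
  rw [lagrange, Finset.sum_pair (by simp [hij])] at hsub
  nlinarith

theorem abs_sub_le_xi {n : ℕ} (θ : Fin n → ℝ) (z : Fin (n + 1) → ℤ) (i : Fin n) :
    |(z 0 : ℝ) * θ i - z i.succ| ≤ xi θ z :=
  le_ciSup (f := fun i => |(z 0 : ℝ) * θ i - z i.succ|) (Set.finite_range _).bddAbove i

theorem xi_nonneg {n : ℕ} (θ : Fin n → ℝ) (z : Fin (n + 1) → ℤ) : 0 ≤ xi θ z :=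
  Real.iSup_nonneg fun _ => abs_nonneg _

/-- Clearing the first coordinate of `x` by a multiple of `y` leaves a vector of size `O(ξ)`. -/
theorem abs_sub_smul_le {n : ℕ} {θ : Fin n → ℝ} {x y : Fin (n + 1) → ℤ} (hx : 0 < x 0)
    (hxy : x 0 ≤ y 0) (hxi : xi θ y ≤ xi θ x) (k : Fin (n + 1)) :
    |(vecR x - ((x 0 : ℝ) / y 0) • vecR y) k| ≤ 2 * xi θ x := by
  have hx' : (0 : ℝ) < x 0 := by exact_mod_cast hx
  have hxy' : (x 0 : ℝ) ≤ y 0 := by exact_mod_cast hxy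
  have hy' : (0 : ℝ) < y 0 := hx'.trans_le hxy'
  refine Fin.cases ?_ (fun i => ?_) k
  · have h0 : (vecR x - ((x 0 : ℝ) / y 0) • vecR y) 0 = 0 := by
      simp [vecR, div_mul_cancel₀ _ hy'.ne']
    rw [h0, abs_zero]
    linarith [xi_nonneg θ x]
  · have hs1 : (x 0 : ℝ) / y 0 ≤ 1 := (div_le_one hy').2 hxy'
    have hs0 : 0 ≤ (x 0 : ℝ) / y 0 := by positivity
    have heq : (vecR x - ((x 0 : ℝ) / y 0) • vecR y) i.succ =
        (x 0 : ℝ) / y 0 * ((y 0 : ℝ) * θ i - y i.succ) - ((x 0 : ℝ) * θ i - x i.succ) := by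
      simp only [vecR, Pi.sub_apply, Pi.smul_apply, smul_eq_mul]
      field_simp
      ring
    rw [heq]
    refine (abs_sub _ _).trans ?_
    rw [abs_mul, abs_of_nonneg hs0]
    have := mul_le_of_le_one_left (abs_nonneg ((y 0 : ℝ) * θ i - y i.succ)) hs1
    linarith [abs_sub_le_xi θ x i, abs_sub_le_xi θ y i]

namespace IsBestApproxSeq

variable {n : ℕ} {θ : Fin n → ℝ} {z : ℕ → Fin (n + 1) → ℤ}

theorem one_le (hz : IsBestApproxSeq θ z) (l : ℕ) : (1 : ℝ) ≤ z l 0 := by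
  exact_mod_cast hz.1 l

theorem xi_le_one (hz : IsBestApproxSeq θ z) (l : ℕ) : xi θ (z l) ≤ 1 := by
  have h1 : z l 0 < z (l + 1) 0 := hz.2.1 l.lt_succ_self
  refine (hz.2.2.2 l 1 one_pos (by have := hz.1 l; omega) fun i => round (θ i)).trans ?_
  refine Real.iSup_le (fun i => ?_) zero_le_one
  rw [Int.cast_one, one_mul]
  linarith [abs_sub_round (θ i)]

theorem abs_vecR_le (hz : IsBestApproxSeq θ z) (l : ℕ) (k : Fin (n + 1)) :
    |vecR (z l) k| ≤ (∑ i, |θ i| + 1) * z l 0 := by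
  have hq := hz.one_le l
  have hsum : 0 ≤ ∑ i, |θ i| := Finset.sum_nonneg fun i _ => abs_nonneg _
  refine Fin.cases ?_ (fun i => ?_) k
  · rw [vecR, abs_of_nonneg (by linarith)]
    nlinarith
  · have h1 := (abs_sub_le_xi θ (z l) i).trans (hz.xi_le_one l)
    have h2 : |θ i| ≤ ∑ i, |θ i| :=
      Finset.single_le_sum (f := fun i => |θ i|) (fun i _ => abs_nonneg _) (Finset.mem_univ i)
    have h3 : |(z l i.succ : ℝ)| ≤
        |(z l 0 : ℝ) * θ i| + |(z l 0 : ℝ) * θ i - z l i.succ| := by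
      simpa using abs_sub ((z l 0 : ℝ) * θ i) ((z l 0 : ℝ) * θ i - z l i.succ)
    rw [abs_mul, abs_of_nonneg (by linarith : (0 : ℝ) ≤ z l 0)] at h3
    simp only [vecR]
    nlinarith

theorem covol_pair_ge (hn : 1 ≤ n) (hz : IsBestApproxSeq θ z) (l : ℕ) :
    1 / 2 * (xi θ (z l) * (z (l + 1) 0 : ℝ)) ≤ covol ![vecR (z l), vecR (z (l + 1))] := by
  have : Nonempty (Fin n) := ⟨⟨0, hn⟩⟩
  have hlt : z l 0 < z (l + 1) 0 := hz.2.1 l.lt_succ_self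
  have hlt' : (z l 0 : ℝ) < z (l + 1) 0 := by exact_mod_cast hlt
  have hxi : xi θ (z (l + 1)) < xi θ (z l) := hz.2.2.1 l.lt_succ_self
  have hq := hz.one_le l
  have hxi0 := xi_nonneg θ (z (l + 1))
  suffices ∃ i : Fin n, 1 / 2 * (xi θ (z l) * (z (l + 1) 0 : ℝ)) ≤
      |vecR (z l) 0 * vecR (z (l + 1)) i.succ - vecR (z l) i.succ * vecR (z (l + 1)) 0| by
    obtain ⟨i, hi⟩ := this
    refine hi.trans (Real.abs_le_sqrt ?_)
    exact sq_minor_le_det_gram _ _ (Fin.succ_ne_zero i).symm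
  simp only [vecR]
  rcases le_total (2 * (z l 0 : ℝ)) (z (l + 1) 0) with h | h
  · obtain ⟨i, hi⟩ := exists_eq_ciSup_of_finite
      (f := fun i : Fin n => |(z l 0 : ℝ) * θ i - z l i.succ|)
    refine ⟨i, ?_⟩
    have hi' : |(z l 0 : ℝ) * θ i - z l i.succ| = xi θ (z l) := hi
    have hb := abs_sub_le_xi θ (z (l + 1)) i
    have key := abs_sub_abs_le_abs_sub ((z (l + 1) 0 : ℝ) * ((z l 0 : ℝ) * θ i - z l i.succ))
      ((z l 0 : ℝ) * ((z (l + 1) 0 : ℝ) * θ i - z (l + 1) i.succ))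
    rw [abs_mul, abs_mul, hi', abs_of_pos (by linarith : (0 : ℝ) < z (l + 1) 0),
      abs_of_pos (by linarith : (0 : ℝ) < z l 0)] at key
    convert_to _ ≤ |(z (l + 1) 0 : ℝ) * ((z l 0 : ℝ) * θ i - z l i.succ) -
      (z l 0 : ℝ) * ((z (l + 1) 0 : ℝ) * θ i - z (l + 1) i.succ)| using 2
    · ring
    refine le_trans ?_ key
    nlinarith
  · obtain ⟨i, hi⟩ := exists_eq_ciSup_of_finite (f := fun i : Fin n =>
      |((z (l + 1) 0 - z l 0 : ℤ) : ℝ) * θ i - ((z (l + 1) i.succ - z l i.succ : ℤ) : ℝ)|)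
    refine ⟨i, ?_⟩
    have hbest := hz.2.2.2 l (z (l + 1) 0 - z l 0) (by omega) (by have := hz.1 l; omega)
      fun i => z (l + 1) i.succ - z l i.succ
    rw [← hi] at hbest
    push_cast at hbest
    have hb := abs_sub_le_xi θ (z (l + 1)) i
    have key := abs_sub_abs_le_abs_sub
      ((z (l + 1) 0 : ℝ) * (((z (l + 1) 0 : ℝ) - z l 0) * θ i - (z (l + 1) i.succ - z l i.succ)))
      (((z (l + 1) 0 : ℝ) - z l 0) * ((z (l + 1) 0 : ℝ) * θ i - z (l + 1) i.succ))
    rw [abs_mul, abs_mul, abs_of_pos (by linarith : (0 : ℝ) < z (l + 1) 0),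
      abs_of_pos (by linarith : (0 : ℝ) < (z (l + 1) 0 : ℝ) - z l 0)] at key
    rw [abs_sub_comm]
    convert_to _ ≤ |(z (l + 1) 0 : ℝ) *
        (((z (l + 1) 0 : ℝ) - z l 0) * θ i - (z (l + 1) i.succ - z l i.succ)) -
      ((z (l + 1) 0 : ℝ) - z l 0) * ((z (l + 1) 0 : ℝ) * θ i - z (l + 1) i.succ)| using 2
    · ring
    refine le_trans ?_ key
    nlinarith

theorem dotProduct_sub_smul_le (hz : IsBestApproxSeq θ z) {k l : ℕ} (hkl : k ≤ l) :
    (vecR (z k) - ((z k 0 : ℝ) / z l 0) • vecR (z l)) ⬝ᵥ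
      (vecR (z k) - ((z k 0 : ℝ) / z l 0) • vecR (z l)) ≤
        ((n + 1 : ℕ) : ℝ) * (2 * xi θ (z k)) ^ 2 :=
  dotProduct_self_le (abs_sub_smul_le (hz.1 k) (hz.2.1.monotone hkl) (hz.2.2.1.antitone hkl))

theorem covol_pair_le (hz : IsBestApproxSeq θ z) {k l : ℕ} (hkl : k ≤ l) :
    covol ![vecR (z k), vecR (z l)] ≤
      2 * (n + 1) * (∑ i, |θ i| + 1) * (xi θ (z k) * (z l 0 : ℝ)) := by
  have hsum : 0 ≤ ∑ i, |θ i| := Finset.sum_nonneg fun i _ => abs_nonneg _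
  have hq := hz.one_le l
  have hx := xi_nonneg θ (z k)
  refine Real.sqrt_le_iff.2 ⟨by positivity, ?_⟩
  rw [← det_gram_pair_sub_smul _ _ ((z k 0 : ℝ) / z l 0)]
  refine (det_gram_pair_le _ _).trans ((mul_le_mul (hz.dotProduct_sub_smul_le hkl)
    (dotProduct_self_le (hz.abs_vecR_le l)) (dotProduct_self_nonneg_real _)
    (by positivity)).trans (le_of_eq ?_))
  push_cast
  ring

theorem covol_triple_le (hz : IsBestApproxSeq θ z) {j k l : ℕ} (hjl : j ≤ l) (hkl : k ≤ l) :
    covol ![vecR (z j), vecR (z k), vecR (z l)] ≤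
      4 * (n + 1) ^ 2 * (∑ i, |θ i| + 1) * (xi θ (z j) * xi θ (z k) * (z l 0 : ℝ)) := by
  have hsum : 0 ≤ ∑ i, |θ i| := Finset.sum_nonneg fun i _ => abs_nonneg _
  have hq := hz.one_le l
  have hx := xi_nonneg θ (z j)
  have hy := xi_nonneg θ (z k)
  refine Real.sqrt_le_iff.2 ⟨by positivity, ?_⟩
  rw [← det_gram_triple_sub_smul _ _ _ ((z j 0 : ℝ) / z l 0) ((z k 0 : ℝ) / z l 0)]
  refine (det_gram_triple_le _ _ _).trans ((mul_le_mul (mul_le_mul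
    (hz.dotProduct_sub_smul_le hjl) (hz.dotProduct_sub_smul_le hkl)
    (dotProduct_self_nonneg_real _) (by positivity))
    (dotProduct_self_le (hz.abs_vecR_le l)) (dotProduct_self_nonneg_real _)
    (by positivity)).trans ?_)
  have hpow : ((n : ℝ) + 1) ^ 3 ≤ ((n : ℝ) + 1) ^ 4 :=
    pow_le_pow_right₀ (by linarith [n.cast_nonneg (α := ℝ)]) (by norm_num)
  have := mul_le_mul_of_nonneg_right hpow
    (sq_nonneg (4 * (∑ i, |θ i| + 1) * (xi θ (z j) * xi θ (z k) * (z l 0 : ℝ))))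
  push_cast
  linarith

end IsBestApproxSeq

/-- Estimates for the covolumes of the rank-2 lattice `Λ_l` generated by
`z_l, z_{l+1}` and of the rank-3 lattice `Γ_l` generated by
`z_{l-1}, z_l, z_{l+1}`; the constants depend only on `n` and `θ`. -/
theorem statement9 {n : ℕ} (hn : 1 ≤ n) (θ : Fin n → ℝ)
    (hθ : LinearIndependent ℚ (Fin.cons (1 : ℝ) θ : Fin (n + 1) → ℝ)) :
    ∃ c₁ c₂ c₃ : ℝ, 0 < c₁ ∧ 0 < c₂ ∧ 0 < c₃ ∧
      ∀ z : ℕ → Fin (n + 1) → ℤ, IsBestApproxSeq θ z →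
      ∀ l : ℕ, 2 ≤ l →
        (c₁ * (xi θ (z l) * (z (l + 1) 0 : ℝ)) ≤ covol ![vecR (z l), vecR (z (l + 1))] ∧
          covol ![vecR (z l), vecR (z (l + 1))] ≤ c₂ * (xi θ (z l) * (z (l + 1) 0 : ℝ))) ∧
        (LinearIndependent ℝ ![vecR (z (l - 1)), vecR (z l), vecR (z (l + 1))] →
          covol ![vecR (z (l - 1)), vecR (z l), vecR (z (l + 1))] ≤
            c₃ * (xi θ (z (l - 1)) * xi θ (z l) * (z (l + 1) 0 : ℝ))) := by
  have hsum : 0 ≤ ∑ i, |θ i| := Finset.sum_nonneg fun i _ => abs_nonneg _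
  refine ⟨1 / 2, 2 * (n + 1) * (∑ i, |θ i| + 1), 4 * (n + 1) ^ 2 * (∑ i, |θ i| + 1),
    by norm_num, by positivity, by positivity, fun z hz l _ =>
      ⟨⟨hz.covol_pair_ge hn l, hz.covol_pair_le l.le_succ⟩, fun _ =>
        hz.covol_triple_le (by omega) l.le_succ⟩⟩

end
end

section
/- Let θ ∈ ℝ³ be such that 1, θ₁, θ₂, θ₃ are linearly independent over ℚ, let (z_l) be a sequence of best approximations to θ, and assume that for every index k₀ the vectors {z_l : l ≥ k₀} span ℝ⁴. Then for every index k₀ there exist indices k > ν > k₀ such that: (i) z_{ν−1}, z_ν, z_{ν+1} are linearly independent and z_{k−1}, z_k, z_{k+1} are linearly independent; (ii) the subgroup of ℤ⁴ generated by z_ν, z_{ν+1} equals the subgroup generated by z_{k−1}, z_k, and equals span_ℝ(z_{ν−1},z_ν,z_{ν+1}) ∩ span_ℝ(z_{k−1},z_k,z_{k+1}) ∩ ℤ⁴; (iii) the six vectors z_{ν−1}, z_ν, z_{ν+1}, z_{k−1}, z_k, z_{k+1} span ℝ⁴. -/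
open scoped BigOperators

noncomputable section

/-- The subgroup of integer points of `ℝ^m`. -/
def intPoints (m : ℕ) : AddSubgroup (Fin m → ℝ) where
  carrier := {v | ∀ i, ∃ k : ℤ, v i = (k : ℝ)}
  zero_mem' := fun i => ⟨0, by simp⟩
  add_mem' := by
    intro a b ha hb i
    obtain ⟨p, hp⟩ := ha i
    obtain ⟨q, hq⟩ := hb i
    exact ⟨p + q, by simp [hp, hq]⟩
  neg_mem' := by
    intro a ha i
    obtain ⟨p, hp⟩ := ha i
    exact ⟨-p, by simp [hp]⟩

open scoped Classical in
/-- Covolume (fundamental volume) of a subgroup of `ℝ^m` generated by some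
linearly independent family of vectors; junk value `0` otherwise. -/
def latticeDet {m : ℕ} (Γ : AddSubgroup (Fin m → ℝ)) : ℝ :=
  if h : ∃ r : ℕ, ∃ v : Fin r → Fin m → ℝ, LinearIndependent ℝ v ∧
      AddSubgroup.closure (Set.range v) = Γ
  then covol h.choose_spec.choose
  else 0

/-- The linear map `x ↦ (x₀ θ_i - x_i)_i` whose sup norm is the approximation error. -/
def errMap {n : ℕ} (θ : Fin n → ℝ) : (Fin (n + 1) → ℝ) →ₗ[ℝ] (Fin n → ℝ) where
  toFun x := fun i => x 0 * θ i - x i.succ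
  map_add' x y := by ext i; simp; ring
  map_smul' c x := by ext i; simp; ring

lemma iSup_abs_eq_norm {n : ℕ} (f : Fin n → ℝ) : ⨆ i, |f i| = ‖f‖ := by
  apply le_antisymm
  · exact Real.iSup_le (fun i => norm_le_pi_norm f i) (norm_nonneg f)
  · rw [pi_norm_le_iff_of_nonneg (Real.iSup_nonneg fun i => abs_nonneg _)]
    exact fun i => le_ciSup (f := fun i => |f i|) (Set.finite_range _).bddAbove i

lemma xi_eq_norm {n : ℕ} (θ : Fin n → ℝ) (z : Fin (n + 1) → ℤ) :
    xi θ z = ‖errMap θ (vecR z)‖ :=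
  iSup_abs_eq_norm (errMap θ (vecR z))

lemma xi_neg {n : ℕ} (θ : Fin n → ℝ) (z : Fin (n + 1) → ℤ) : xi θ (-z) = xi θ z := by
  have h : vecR (-z) = -vecR z := by ext i; simp [vecR]
  rw [xi_eq_norm, xi_eq_norm, h, map_neg, norm_neg]

lemma vecR_mem_intPoints {m : ℕ} (z : Fin m → ℤ) : vecR z ∈ intPoints m := fun i => ⟨z i, rfl⟩

lemma exists_vecR_eq {m : ℕ} {x : Fin m → ℝ} (hx : x ∈ intPoints m) :
    ∃ u : Fin m → ℤ, vecR u = x := by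
  choose u hu using hx
  exact ⟨u, funext fun i => (hu i).symm⟩

namespace IsBestApproxSeq

variable {n : ℕ} {θ : Fin n → ℝ} {z : ℕ → Fin (n + 1) → ℤ}

lemma xi_le_half (hz : IsBestApproxSeq θ z) (l : ℕ) : xi θ (z l) ≤ 1 / 2 := by
  refine (hz.2.2.2 l (z l 0) (hz.1 l) (hz.2.1 l.lt_succ_self)
    fun i => round ((z l 0 : ℝ) * θ i)).trans ?_
  exact Real.iSup_le (fun i => abs_sub_round _) (by norm_num)

/-- An integer vector whose height and error are both too small vanishes. -/
lemma eq_zero_of_small (hz : IsBestApproxSeq θ z) {l : ℕ} {u : Fin (n + 1) → ℤ}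
    (hu : |u 0| < z (l + 1) 0) (hxi : xi θ u < xi θ (z l)) : u = 0 := by
  have key : ∀ v : Fin (n + 1) → ℤ, 0 < v 0 → v 0 < z (l + 1) 0 → xi θ (z l) ≤ xi θ v :=
    fun v h0 h1 => hz.2.2.2 l (v 0) h0 h1 fun i => v i.succ
  rw [abs_lt] at hu
  rcases lt_trichotomy (u 0) 0 with h | h | h
  · have := key (-u) (by simpa using h) (by simp only [Pi.neg_apply]; linarith)
    rw [xi_neg] at this
    linarith
  · have hle := hz.xi_le_half l
    ext i
    refine Fin.cases h (fun i => ?_) i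
    by_contra hi
    have h1 : (1 : ℝ) ≤ |(u i.succ : ℝ)| := by exact_mod_cast Int.one_le_abs hi
    have h2 := norm_le_pi_norm (errMap θ (vecR u)) i
    rw [← xi_eq_norm] at h2
    simp only [errMap, vecR, LinearMap.coe_mk, AddHom.coe_mk, h, Int.cast_zero, zero_mul,
      zero_sub, norm_neg, Real.norm_eq_abs] at h2
    linarith
  · linarith [key u h hu.2]

lemma linearIndependent_pair (hz : IsBestApproxSeq θ z) (l : ℕ) :
    LinearIndependent ℝ ![vecR (z l), vecR (z (l + 1))] := by
  have h0 : (0 : ℝ) < z l 0 := by exact_mod_cast hz.1 l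
  have h1 : (z l 0 : ℝ) < z (l + 1) 0 := by exact_mod_cast hz.2.1 l.lt_succ_self
  rw [LinearIndependent.pair_iff' (fun h => h0.ne' (congrFun h 0))]
  intro a ha
  have ha0 : a * (z l 0 : ℝ) = z (l + 1) 0 := congrFun ha 0
  have ha1 : 1 < a := by by_contra! h; nlinarith
  have hx : xi θ (z (l + 1)) < xi θ (z l) := hz.2.2.1 l.lt_succ_self
  rw [xi_eq_norm, xi_eq_norm, ← ha, map_smul, norm_smul, Real.norm_of_nonneg (by linarith)] at hx
  nlinarith [norm_nonneg (errMap θ (vecR (z l)))]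

/-- Two consecutive best approximations form a basis of the integer points of their plane. -/
lemma closure_pair_eq (hz : IsBestApproxSeq θ z) (l : ℕ) :
    AddSubgroup.closure ({vecR (z l), vecR (z (l + 1))} : Set (Fin (n + 1) → ℝ)) =
      (Submodule.span ℝ {vecR (z l), vecR (z (l + 1))}).toAddSubgroup ⊓ intPoints (n + 1) := by
  apply le_antisymm
  · rw [AddSubgroup.closure_le]
    intro x hx
    refine ⟨Submodule.subset_span hx, ?_⟩
    rcases hx with rfl | rfl <;> exact vecR_mem_intPoints _
  · rintro x ⟨hx, hxi⟩
    obtain ⟨a, b, rfl⟩ := Submodule.mem_span_pair.1 hx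
    set Λ := AddSubgroup.closure ({vecR (z l), vecR (z (l + 1))} : Set (Fin (n + 1) → ℝ))
    have hv : vecR (z l) ∈ Λ := AddSubgroup.subset_closure (by simp)
    have hw : vecR (z (l + 1)) ∈ Λ := AddSubgroup.subset_closure (by simp)
    have hs : round a • vecR (z l) + round b • vecR (z (l + 1)) ∈ Λ :=
      add_mem (zsmul_mem hv _) (zsmul_mem hw _)
    obtain ⟨u, hu⟩ := exists_vecR_eq (sub_mem hxi (add_mem
      (zsmul_mem (vecR_mem_intPoints (z l)) (round a))
      (zsmul_mem (vecR_mem_intPoints (z (l + 1))) (round b))))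
    have hu' : vecR u = (a - round a) • vecR (z l) + (b - round b) • vecR (z (l + 1)) := by
      rw [hu]; ext i; simp; ring
    have ha := abs_sub_round a
    have hb := abs_sub_round b
    have h0 : (0 : ℝ) < z l 0 := by exact_mod_cast hz.1 l
    have h1 : (z l 0 : ℝ) < z (l + 1) 0 := by exact_mod_cast hz.2.1 l.lt_succ_self
    have hx : xi θ (z (l + 1)) < xi θ (z l) := hz.2.2.1 l.lt_succ_self
    have hu0 : u = 0 := by
      apply hz.eq_zero_of_small (l := l)
      · have he : (u 0 : ℝ) = (a - round a) * z l 0 + (b - round b) * z (l + 1) 0 :=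
          congrFun hu' 0
        have : |(u 0 : ℝ)| < z (l + 1) 0 := by
          rw [he]
          refine (abs_add_le _ _).trans_lt ?_
          rw [abs_mul, abs_mul, abs_of_pos h0, abs_of_pos (h0.trans h1)]
          nlinarith
        exact_mod_cast this
      · rw [xi_eq_norm θ u, hu', map_add, map_smul, map_smul]
        refine (norm_add_le _ _).trans_lt ?_
        rw [norm_smul, norm_smul, ← xi_eq_norm, ← xi_eq_norm, Real.norm_eq_abs, Real.norm_eq_abs]
        have : 0 ≤ xi θ (z (l + 1)) := by rw [xi_eq_norm]; exact norm_nonneg _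
        nlinarith
    have hz0 : vecR u = 0 := by rw [hu0]; ext i; simp [vecR]
    rw [hz0, eq_comm, sub_eq_zero] at hu
    rw [hu]
    exact hs

end IsBestApproxSeq

section SpanConsecutive

variable {V : Type*} [AddCommGroup V] [Module ℝ V] {v : ℕ → V}

lemma finrank_span_pair_eq_two {x y : V} (h : LinearIndependent ℝ ![x, y]) :
    Module.finrank ℝ (Submodule.span ℝ {x, y}) = 2 := by
  have := finrank_span_eq_card h
  rwa [Matrix.range_cons, Matrix.range_cons, Matrix.range_empty, Set.union_empty,
    Fintype.card_fin] at this

lemma finrank_span_triple_eq_three {x y w : V} (h : LinearIndependent ℝ ![x, y, w]) :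
    Module.finrank ℝ (Submodule.span ℝ {x, y, w}) = 3 := by
  have := finrank_span_eq_card h
  rwa [Matrix.range_cons, Matrix.range_cons, Matrix.range_cons, Matrix.range_empty,
    Set.union_empty, Fintype.card_fin] at this

lemma linearIndependent_triple_of_notMem {x y w : V} (h : LinearIndependent ℝ ![x, y])
    (hw : w ∉ Submodule.span ℝ {x, y}) : LinearIndependent ℝ ![x, y, w] := by
  have h' : LinearIndependent ℝ (Fin.snoc ![x, y] w : Fin 3 → V) :=
    linearIndependent_finSnoc.2 ⟨h, by simpa [Set.pair_comm] using hw⟩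
  convert h' using 1
  ext i
  fin_cases i <;> rfl

lemma span_pair_succ_eq (hv : ∀ l, LinearIndependent ℝ ![v l, v (l + 1)]) {l : ℕ}
    (h : v (l + 2) ∈ Submodule.span ℝ {v l, v (l + 1)}) :
    Submodule.span ℝ {v (l + 1), v (l + 2)} = Submodule.span ℝ {v l, v (l + 1)} := by
  have : FiniteDimensional ℝ (Submodule.span ℝ {v l, v (l + 1)}) :=
    FiniteDimensional.span_of_finite ℝ (Set.toFinite _)
  refine Submodule.eq_of_le_of_finrank_eq ?_ ?_
  · rw [Submodule.span_le]
    rintro x (rfl | rfl)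
    · exact Submodule.subset_span (by simp)
    · exact h
  · rw [finrank_span_pair_eq_two (hv l), finrank_span_pair_eq_two (hv (l + 1))]

lemma span_pair_le_span_triple (x y w : V) :
    Submodule.span ℝ {x, y} ≤ Submodule.span ℝ {x, y, w} := by
  apply Submodule.span_mono
  rintro _ (rfl | rfl) <;> simp

lemma span_pair_le_span_triple' (x y w : V) :
    Submodule.span ℝ {y, w} ≤ Submodule.span ℝ {x, y, w} :=
  Submodule.span_mono (Set.subset_insert _ _)

/-- If consecutive terms are independent and the tails span a space of dimension at least four,
then there are arbitrarily late independent triples of consecutive terms that share a plane and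
span different three-dimensional spaces. -/
lemma exists_triples_sharing_plane (hdim : 4 ≤ Module.finrank ℝ V)
    (hv : ∀ l, LinearIndependent ℝ ![v l, v (l + 1)])
    (hspan : ∀ k₀ : ℕ, Submodule.span ℝ {x | ∃ l, k₀ ≤ l ∧ x = v l} = ⊤) (k₀ : ℕ) :
    ∃ ν k : ℕ, k₀ ≤ ν ∧ ν < k ∧
      v (ν + 2) ∉ Submodule.span ℝ {v ν, v (ν + 1)} ∧
      v (k + 2) ∉ Submodule.span ℝ {v k, v (k + 1)} ∧
      Submodule.span ℝ {v (ν + 1), v (ν + 2)} = Submodule.span ℝ {v k, v (k + 1)} ∧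
      Submodule.span ℝ {v ν, v (ν + 1), v (ν + 2)} ≠
        Submodule.span ℝ {v k, v (k + 1), v (k + 2)} := by
  have tail : ∀ (m : ℕ) (s : Finset V), s.card ≤ 3 →
      (∀ l, m ≤ l → v l ∈ Submodule.span ℝ (s : Set V)) → False := by
    intro m s hs h
    have htop : Submodule.span ℝ (s : Set V) = ⊤ := by
      rw [eq_top_iff, ← hspan m, Submodule.span_le]
      rintro _ ⟨l, hl, rfl⟩
      exact h l hl
    have hle := finrank_span_finset_le_card (R := ℝ) s
    rw [Set.finrank, htop, finrank_top] at hle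
    omega
  classical
  obtain ⟨μ, hμ, hgood⟩ : ∃ μ, k₀ ≤ μ ∧ v (μ + 2) ∉ Submodule.span ℝ {v μ, v (μ + 1)} := by
    by_contra! h
    have hP : ∀ l, k₀ ≤ l → Submodule.span ℝ {v l, v (l + 1)} =
        Submodule.span ℝ {v k₀, v (k₀ + 1)} := by
      intro l hl
      induction l, hl using Nat.le_induction with
      | base => rfl
      | succ l hl ih => exact (span_pair_succ_eq hv (h l hl)).trans ih
    refine tail k₀ {v k₀, v (k₀ + 1)} (Finset.card_le_two.trans (by norm_num)) fun l hl => ?_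
    rw [Finset.coe_pair, ← hP l hl]
    exact Submodule.subset_span (by simp)
  by_contra! hcon
  have inv : ∀ l, μ ≤ l → ∃ ν, μ ≤ ν ∧ ν ≤ l ∧
      v (ν + 2) ∉ Submodule.span ℝ {v ν, v (ν + 1)} ∧
      Submodule.span ℝ {v (ν + 1), v (ν + 2)} = Submodule.span ℝ {v (l + 1), v (l + 2)} ∧
      Submodule.span ℝ {v ν, v (ν + 1), v (ν + 2)} =
        Submodule.span ℝ {v μ, v (μ + 1), v (μ + 2)} := by
    intro l hl
    induction l, hl using Nat.le_induction with
    | base => exact ⟨μ, le_rfl, le_rfl, hgood, rfl, rfl⟩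
    | succ l hl ih =>
      obtain ⟨ν, h1, h2, h3, h4, h5⟩ := ih
      by_cases h : v (l + 3) ∈ Submodule.span ℝ {v (l + 1), v (l + 2)}
      · exact ⟨ν, h1, by omega, h3, h4.trans (span_pair_succ_eq hv h).symm, h5⟩
      · exact ⟨l + 1, by omega, le_rfl, h, rfl,
          (hcon ν (l + 1) (hμ.trans h1) (by omega) h3 h h4).symm.trans h5⟩
  refine tail (μ + 1) {v μ, v (μ + 1), v (μ + 2)} Finset.card_le_three fun l hl => ?_
  obtain ⟨l, rfl⟩ : ∃ m, l = m + 1 := ⟨l - 1, by omega⟩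
  obtain ⟨ν, -, -, -, h4, h5⟩ := inv l (by omega)
  have hmem : v (l + 1) ∈ Submodule.span ℝ {v (l + 1), v (l + 2)} :=
    Submodule.subset_span (by simp)
  rw [← h4] at hmem
  have := span_pair_le_span_triple' (v ν) _ _ hmem
  rw [h5] at this
  simpa using this

end SpanConsecutive

/-- The basic pattern for simultaneous approximation to three numbers: two
triples of consecutive best approximation vectors, independent, sharing a
common 2-dimensional lattice, and jointly spanning `ℝ⁴`. -/
theorem statement12 (θ : Fin 3 → ℝ)
    (hθ : LinearIndependent ℚ (Fin.cons (1 : ℝ) θ : Fin (3 + 1) → ℝ))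
    (z : ℕ → Fin (3 + 1) → ℤ) (hz : IsBestApproxSeq θ z)
    (hspan : ∀ k₀ : ℕ,
      Submodule.span ℝ {x : Fin (3 + 1) → ℝ | ∃ l, k₀ ≤ l ∧ x = vecR (z l)} = ⊤) :
    ∀ k₀ : ℕ, ∃ ν k : ℕ, k₀ < ν ∧ ν < k ∧
      LinearIndependent ℝ ![vecR (z (ν - 1)), vecR (z ν), vecR (z (ν + 1))] ∧
      LinearIndependent ℝ ![vecR (z (k - 1)), vecR (z k), vecR (z (k + 1))] ∧
      AddSubgroup.closure ({vecR (z ν), vecR (z (ν + 1))} : Set (Fin (3 + 1) → ℝ)) =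
        AddSubgroup.closure ({vecR (z (k - 1)), vecR (z k)} : Set (Fin (3 + 1) → ℝ)) ∧
      AddSubgroup.closure ({vecR (z ν), vecR (z (ν + 1))} : Set (Fin (3 + 1) → ℝ)) =
        (Submodule.span ℝ ({vecR (z (ν - 1)), vecR (z ν), vecR (z (ν + 1))} :
          Set (Fin (3 + 1) → ℝ))).toAddSubgroup ⊓
        (Submodule.span ℝ ({vecR (z (k - 1)), vecR (z k), vecR (z (k + 1))} :
          Set (Fin (3 + 1) → ℝ))).toAddSubgroup ⊓ intPoints (3 + 1) ∧
      Submodule.span ℝ ({vecR (z (ν - 1)), vecR (z ν), vecR (z (ν + 1)),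
        vecR (z (k - 1)), vecR (z k), vecR (z (k + 1))} : Set (Fin (3 + 1) → ℝ)) = ⊤ := by
  intro k₀
  have hv := hz.linearIndependent_pair
  obtain ⟨ν, k, hν, hνk, gν, gk, hP, hT⟩ := exists_triples_sharing_plane
    (v := fun l => vecR (z l)) (by simp) hv hspan k₀
  have iν := linearIndependent_triple_of_notMem (hv ν) gν
  have ik := linearIndependent_triple_of_notMem (hv k) gk
  have fν := finrank_span_triple_eq_three iν
  have fk := finrank_span_triple_eq_three ik
  have hsup : Submodule.span ℝ {vecR (z ν), vecR (z (ν + 1)), vecR (z (ν + 2))} ⊔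
      Submodule.span ℝ {vecR (z k), vecR (z (k + 1)), vecR (z (k + 2))} = ⊤ := by
    apply Submodule.eq_top_of_finrank_eq
    have hlt := Submodule.finrank_lt_finrank_of_lt (left_lt_sup.2 fun hle =>
      hT (Submodule.eq_of_le_of_finrank_eq hle (fk.trans fν.symm)).symm)
    have hle := Submodule.finrank_le
      (Submodule.span ℝ {vecR (z ν), vecR (z (ν + 1)), vecR (z (ν + 2))} ⊔
        Submodule.span ℝ {vecR (z k), vecR (z (k + 1)), vecR (z (k + 2))})
    rw [Module.finrank_fin_fun] at hle ⊢
    omega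
  have hinf : Submodule.span ℝ {vecR (z (ν + 1)), vecR (z (ν + 2))} =
      Submodule.span ℝ {vecR (z ν), vecR (z (ν + 1)), vecR (z (ν + 2))} ⊓
        Submodule.span ℝ {vecR (z k), vecR (z (k + 1)), vecR (z (k + 2))} := by
    apply Submodule.eq_of_le_of_finrank_eq
    · exact le_inf (span_pair_le_span_triple' _ _ _)
        (hP.le.trans (span_pair_le_span_triple _ _ _))
    · have hadd := Submodule.finrank_sup_add_finrank_inf_eq
        (Submodule.span ℝ {vecR (z ν), vecR (z (ν + 1)), vecR (z (ν + 2))})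
        (Submodule.span ℝ {vecR (z k), vecR (z (k + 1)), vecR (z (k + 2))})
      rw [hsup, finrank_top, Module.finrank_fin_fun] at hadd
      have : Module.finrank ℝ (Submodule.span ℝ {vecR (z (ν + 1)), vecR (z (ν + 2))}) = 2 :=
        finrank_span_pair_eq_two (hv (ν + 1))
      omega
  refine ⟨ν + 1, k + 1, by omega, by omega, iν, ik, ?_, ?_, ?_⟩
  · rw [hz.closure_pair_eq (ν + 1), Nat.add_sub_cancel, hz.closure_pair_eq k]
    exact congrArg (fun W : Submodule ℝ _ => W.toAddSubgroup ⊓ intPoints (3 + 1)) hP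
  · rw [hz.closure_pair_eq (ν + 1)]
    exact congrArg (fun W : Submodule ℝ _ => W.toAddSubgroup ⊓ intPoints (3 + 1)) hinf
  · rw [eq_top_iff, ← hsup, ← Submodule.span_union]
    apply Submodule.span_mono
    rintro x ((rfl | rfl | rfl) | (rfl | rfl | rfl)) <;> simp

end
end
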